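/- Let G be a finite group with conjugacy classes K_0, …, K_m, let \hat{K_j} = ∑_{k ∈ K_j} k ∈ ℂ[G] be the class sums, and let P = ∏_{j=0}^{m} |K_j|. Then in the group algebra ℂ[G] the following identity holds: (∏_{j=0}^{m} \hat{K_j})² = (P²/|G'|) · ∑_{g ∈ G'} g. -/

import Mathlib

open Polynomial in
/-- The traces of the powers of an endomorphism of finite order `n` are the values of a single
integer polynomial at the powers of a primitive `n`-th root of unity. -/
theorem Module.End.exists_trace_pow_eq_aeval {V : Type*} [AddCommGroup V] [Module ℂ V]
    [FiniteDimensional ℂ V] {n : ℕ} [NeZero n] {ζ : ℂ} (hζ : IsPrimitiveRoot ζ n)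
    (f : Module.End ℂ V) (hf : f ^ n = 1) :
    ∃ P : ℤ[X], ∀ k : ℕ, LinearMap.trace ℂ V (f ^ k) = aeval (ζ ^ k) P := by
  have hss : f.IsSemisimple := by
    refine isSemisimple_of_squarefree_aeval_eq_zero (p := X ^ n - 1) ?_ (by simp [hf])
    exact (separable_X_pow_sub_C (1 : ℂ) (by simp [NeZero.ne]) one_ne_zero).squarefree
  have hpow (μ : ℂ) (k : ℕ) (v : V) (hv : f v = μ • v) : (f ^ k) v = μ ^ k • v := by
    induction k with
    | zero => simp
    | succ k ih => rw [pow_succ', Module.End.mul_apply, ih, map_smul, hv, smul_smul, pow_succ]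
  have hinj : Function.Injective fun i : Fin n ↦ ζ ^ (i : ℕ) :=
    fun i j h ↦ Fin.ext (hζ.pow_inj i.2 j.2 h)
  have htop : ⨆ i : Fin n, f.eigenspace (ζ ^ (i : ℕ)) = ⊤ := by
    rw [eq_top_iff, ← hss.iSup_eigenspace_eq_top]
    refine iSup_le fun μ v hv ↦ ?_
    rw [mem_eigenspace_iff] at hv
    obtain rfl | hv0 := eq_or_ne v 0
    · exact zero_mem _
    have h1 : (μ ^ n - 1) • v = 0 := by
      rw [sub_smul, ← hpow μ n v hv, hf]; simp
    have h2 : μ ^ n = 1 := sub_eq_zero.1 ((smul_eq_zero.1 h1).resolve_right hv0)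
    obtain ⟨i, hi, rfl⟩ := hζ.eq_pow_of_pow_eq_one h2
    exact Submodule.mem_iSup_of_mem (⟨i, hi⟩ : Fin n) (mem_eigenspace_iff.2 hv)
  have hint := DirectSum.isInternal_submodule_of_iSupIndep_of_iSup_eq_top
    (f.eigenspaces_iSupIndep.comp hinj) htop
  refine ⟨∑ i : Fin n, (Module.finrank ℂ (f.eigenspace (ζ ^ (i : ℕ))) : ℤ[X]) * X ^ (i : ℕ),
    fun k ↦ ?_⟩
  have hmaps (i : Fin n) : Set.MapsTo (f ^ k) (f.eigenspace (ζ ^ (i : ℕ)))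
      (f.eigenspace (ζ ^ (i : ℕ))) := fun v hv ↦ by
    rw [SetLike.mem_coe, mem_eigenspace_iff] at hv
    rw [hpow _ k v hv]
    exact Submodule.smul_mem _ _ (mem_eigenspace_iff.2 hv)
  rw [LinearMap.trace_eq_sum_trace_restrict hint hmaps, map_sum]
  refine Finset.sum_congr rfl fun i _ ↦ ?_
  have hr : (f ^ k).restrict (hmaps i) = ((ζ ^ (i : ℕ)) ^ k) • LinearMap.id := by
    ext v
    exact hpow _ k v (mem_eigenspace_iff.1 v.2)
  rw [hr, map_smul, LinearMap.trace_id]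
  simp [mul_comm, ← pow_mul]

/-- If positive reals have sum at most their number and product at least one,
they are all equal to one. -/
theorem Finset.eq_one_of_sum_le_card_of_one_le_prod {ι : Type*} {s : Finset ι} {z : ι → ℝ}
    (hz : ∀ i ∈ s, 0 < z i) (hsum : ∑ i ∈ s, z i ≤ s.card) (hprod : 1 ≤ ∏ i ∈ s, z i) :
    ∀ i ∈ s, z i = 1 := by
  have hlog : 0 ≤ ∑ i ∈ s, Real.log (z i) := by
    rw [← Real.log_prod fun i hi ↦ (hz i hi).ne']
    exact Real.log_nonneg hprod
  by_contra! ⟨i, hi, hne⟩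
  have : ∑ i ∈ s, Real.log (z i) < ∑ i ∈ s, (z i - 1) :=
    Finset.sum_lt_sum (fun j hj ↦ Real.log_le_sub_one_of_pos (hz j hj))
      ⟨i, hi, Real.log_lt_sub_one_of_pos (hz i hi) hne⟩
  rw [Finset.sum_sub_distrib, Finset.sum_const, nsmul_one] at this
  linarith

namespace Representation

variable {G V : Type*} [Group G] [AddCommGroup V] [Module ℂ V] [FiniteDimensional ℂ V]

theorem character_inv_eq_conj [Finite G] (ρ : Representation ℂ G V) (g : G) :
    ρ.character g⁻¹ = starRingEnd ℂ (ρ.character g) := by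
  have hn : NeZero (Nat.card G) := ⟨Nat.card_pos.ne'⟩
  have hζ := Complex.isPrimitiveRoot_exp (Nat.card G) hn.out
  set ζ := Complex.exp (2 * Real.pi * Complex.I / (Nat.card G))
  obtain ⟨P, hP⟩ := Module.End.exists_trace_pow_eq_aeval hζ (ρ g)
    (by rw [← map_pow, pow_card_eq_one', map_one])
  have h1 := hP 1
  have h2 := hP (Nat.card G - 1)
  have hg : g ^ (Nat.card G - 1) = g⁻¹ := by
    rw [eq_inv_iff_mul_eq_one, ← pow_succ, Nat.sub_add_cancel Nat.card_pos, pow_card_eq_one']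
  have hc : ζ ^ (Nat.card G - 1) = starRingEnd ℂ ζ := by
    rw [← Complex.inv_eq_conj (hζ.norm'_eq_one hn.out)]
    refine eq_inv_of_mul_eq_one_left ?_
    rw [← pow_succ, Nat.sub_add_cancel Nat.card_pos, hζ.pow_eq_one]
  rw [← map_pow, hg, hc] at h2
  rw [pow_one, pow_one] at h1
  rw [character, character, h1, h2]
  exact Polynomial.aeval_algHom_apply ((starRingEnd ℂ).toIntAlgHom) ζ P

/-- The product of all values of a character of a finite group is an integer. -/
theorem exists_int_prod_character_eq [Fintype G] (ρ : Representation ℂ G V) :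
    ∃ a : ℤ, ∏ g : G, ρ.character g = a := by
  have hn : NeZero (Nat.card G) := ⟨Nat.card_pos.ne'⟩
  set n := Nat.card G
  let K := CyclotomicField n ℚ
  have : NeZero (n : ℚ) := ⟨Nat.cast_ne_zero.2 hn.out⟩
  have : IsCyclotomicExtension {n} ℚ K := CyclotomicField.isCyclotomicExtension n ℚ
  have hζK := IsCyclotomicExtension.zeta_spec n ℚ K
  set z : K := IsCyclotomicExtension.zeta n ℚ K
  let φ : K →ₐ[ℚ] ℂ := IsAlgClosed.lift
  have hζ : IsPrimitiveRoot (φ z) n := hζK.map_of_injective (f := φ) φ.toRingHom.injective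
  choose P hP using fun g ↦ Module.End.exists_trace_pow_eq_aeval hζ (ρ g)
    (by rw [← map_pow, pow_card_eq_one', map_one])
  have hφ (x : K) (p : Polynomial ℤ) : φ (Polynomial.aeval x p) = Polynomial.aeval (φ x) p :=
    (Polynomial.aeval_algHom_apply (φ.restrictScalars ℤ) x p).symm
  let x : K := ∏ g : G, Polynomial.aeval z (P g)
  have hx : φ x = ∏ g : G, ρ.character g := by
    rw [map_prod]
    refine Finset.prod_congr rfl fun g _ ↦ ?_
    rw [hφ, character]
    simpa using (hP g 1).symm
  have hfix (σ : Gal(K/ℚ)) : σ x = x := by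
    obtain ⟨t, -, ht, htz⟩ := (hζK.isPrimitiveRoot_iff).1 (hζK.map_of_injective σ.injective)
    apply φ.toRingHom.injective
    change φ (σ x) = φ x
    have hσ (p : Polynomial ℤ) : σ (Polynomial.aeval z p) = Polynomial.aeval (z ^ t) p := by
      rw [htz]
      exact (Polynomial.aeval_algHom_apply (σ.toAlgHom.restrictScalars ℤ) z p).symm
    rw [hx, map_prod, map_prod, ← (powCoprime (G := G) ht.symm).prod_comp ρ.character]
    refine Finset.prod_congr rfl fun g _ ↦ ?_
    rw [hσ, hφ, map_pow, ← hP g t, ← map_pow]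
    rfl
  have hgal := IsCyclotomicExtension.isGalois {n} ℚ K
  have hfin := IsCyclotomicExtension.finiteDimensional {n} ℚ K
  obtain ⟨q, hq⟩ := IntermediateField.mem_bot.1 ((IsGalois.mem_bot_iff_fixed x).2 hfix)
  have hint : IsIntegral ℤ x := by
    refine IsIntegral.prod _ fun g _ ↦ ?_
    exact adjoin_le_integralClosure (hζK.isIntegral (NeZero.pos n))
      (Polynomial.aeval_mem_adjoin_singleton _ _)
  rw [← hq, isIntegral_algebraMap_iff (algebraMap ℚ K).injective] at hint
  obtain ⟨a, ha⟩ := IsIntegrallyClosed.isIntegral_iff.1 hint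
  refine ⟨a, ?_⟩
  rw [← hx, ← hq, ← ha]
  simp

/-- **Burnside's theorem on zeros of characters**: an irreducible character without zeros
is linear. -/
theorem IsIrreducible.finrank_eq_one_of_character_ne_zero [Finite G] (ρ : Representation ℂ G V)
    [IsIrreducible ρ] (h : ∀ g, ρ.character g ≠ 0) : Module.finrank ℂ V = 1 := by
  have := Fintype.ofFinite G
  have hinv : Invertible (Nat.card G : ℂ) :=
    invertibleOfNonzero (Nat.cast_ne_zero.2 Nat.card_pos.ne')
  have hsum : ∑ g : G, ‖ρ.character g‖ ^ 2 = Nat.card G := by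
    have h1 := char_orthonormal ρ ρ
    rw [if_pos ⟨Equiv.refl ρ⟩, inv_mul_eq_one₀ hinv.ne_zero] at h1
    simp_rw [character_inv_eq_conj, Complex.mul_conj, Complex.normSq_eq_norm_sq] at h1
    exact_mod_cast h1.symm
  have hprod : 1 ≤ ∏ g : G, ‖ρ.character g‖ ^ 2 := by
    obtain ⟨a, ha⟩ := exists_int_prod_character_eq ρ
    have ha0 : a ≠ 0 := by
      rintro rfl
      exact Finset.prod_ne_zero_iff.2 (fun g _ ↦ h g) (by simpa using ha)
    rw [Finset.prod_pow, ← norm_prod, ha, Complex.norm_intCast]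
    exact one_le_pow₀ (by exact_mod_cast Int.one_le_abs ha0)
  have h1 := Finset.eq_one_of_sum_le_card_of_one_le_prod
    (fun g _ ↦ pow_pos (norm_pos_iff.2 (h g)) 2)
    (by rw [hsum, Finset.card_univ, Fintype.card_eq_nat_card]) hprod 1 (Finset.mem_univ _)
  rw [char_one, Complex.norm_natCast] at h1
  exact_mod_cast (pow_eq_one_iff_of_nonneg (Nat.cast_nonneg _) two_ne_zero).1 h1

/-- Schur's lemma. -/
theorem IsIrreducible.exists_eq_smul_one (ρ : Representation ℂ G V) [IsIrreducible ρ]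
    (T : Module.End ℂ V) (hT : ∀ g, Commute T (ρ g)) : ∃ c : ℂ, T = c • 1 := by
  let f : IntertwiningMap ρ ρ := ⟨T, fun g ↦ (hT g).eq⟩
  obtain ⟨c, hc⟩ := (algebraMap_intertwiningMap_bijective_of_isAlgClosed (ρ := ρ)).2 f
  exact ⟨c, (congrArg IntertwiningMap.toLinearMap hc).symm⟩

omit [FiniteDimensional ℂ V] in
theorem commute_sum_of_conj_mem (ρ : Representation ℂ G V) (s : Finset G)
    (hs : ∀ h, ∀ g ∈ s, h * g * h⁻¹ ∈ s) (h : G) : Commute (∑ g ∈ s, ρ g) (ρ h) := by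
  rw [commute_iff_eq, Finset.sum_mul, Finset.mul_sum]
  symm
  refine Finset.sum_bij' (fun g _ ↦ h * g * h⁻¹) (fun g _ ↦ h⁻¹ * g * h) (hs h)
    (fun g hg ↦ by simpa using hs h⁻¹ g hg) ?_ ?_ ?_ <;> intros <;> simp [← map_mul, mul_assoc]

omit [FiniteDimensional ℂ V] in
theorem asAlgebraHom_finsum_mem_of [Fintype G] (ρ : Representation ℂ G V) (s : Set G)
    [Fintype s] :
    ρ.asAlgebraHom (∑ᶠ g ∈ s, MonoidAlgebra.of ℂ G g) = ∑ g ∈ s.toFinset, ρ g := by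
  rw [finsum_mem_eq_toFinset_sum, map_sum]
  simp

omit [FiniteDimensional ℂ V] in
theorem IsIrreducible.nontrivial (ρ : Representation ℂ G V) [IsIrreducible ρ] : Nontrivial V :=
  have := IsSimpleModule.nontrivial (MonoidAlgebra ℂ G) ρ.asModule
  ρ.asModuleEquiv.injective.nontrivial

/-- A class sum acts as zero in an irreducible representation whose character vanishes
on the class. -/
theorem IsIrreducible.asAlgebraHom_classSum_eq_zero [Finite G] (ρ : Representation ℂ G V)
    [IsIrreducible ρ] {g : G} (hg : ρ.character g = 0) :
    ρ.asAlgebraHom (∑ᶠ x ∈ (ConjClasses.mk g).carrier, MonoidAlgebra.of ℂ G x) = 0 := by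
  classical
  have := Fintype.ofFinite G
  rw [asAlgebraHom_finsum_mem_of]
  obtain ⟨c, hc⟩ := exists_eq_smul_one ρ _ (commute_sum_of_conj_mem ρ
    (ConjClasses.mk g).carrier.toFinset fun h x hx ↦ by
      rw [Set.mem_toFinset, ConjClasses.mem_carrier_iff_mk_eq] at hx ⊢
      rw [← hx, ConjClasses.mk_eq_mk_iff_isConj, isConj_comm, isConj_iff]
      exact ⟨h, rfl⟩)
  have htr := congrArg (LinearMap.trace ℂ V) hc
  rw [map_sum, Finset.sum_eq_zero, map_smul, LinearMap.trace_one] at htr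
  · have := nontrivial ρ
    rw [hc, (smul_eq_zero.1 htr.symm).resolve_right
      (Nat.cast_ne_zero.2 Module.finrank_pos.ne'), zero_smul]
  · intro x hx
    rw [Set.mem_toFinset, ConjClasses.mem_carrier_iff_mk_eq, ConjClasses.mk_eq_mk_iff_isConj,
      isConj_comm, isConj_iff] at hx
    obtain ⟨h, rfl⟩ := hx
    exact (char_conj ρ g h).trans hg

open scoped commutatorElement in
/-- The sum over the commutator subgroup acts as zero in an irreducible representation whose
character has a zero. -/
theorem IsIrreducible.asAlgebraHom_sum_commutator_eq_zero [Finite G] (ρ : Representation ℂ G V)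
    [IsIrreducible ρ] {g : G} (hg : ρ.character g = 0) :
    ρ.asAlgebraHom (∑ᶠ x ∈ (commutator G : Set G), MonoidAlgebra.of ℂ G x) = 0 := by
  classical
  have := Fintype.ofFinite G
  have := nontrivial ρ
  rw [asAlgebraHom_finsum_mem_of]
  obtain ⟨c, hc⟩ := exists_eq_smul_one ρ _ (commute_sum_of_conj_mem ρ
    (commutator G : Set G).toFinset fun h x hx ↦ by
      rw [Set.mem_toFinset, SetLike.mem_coe] at hx ⊢
      exact Subgroup.Normal.conj_mem inferInstance x hx h)
  rw [hc]
  by_contra hne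
  have hc0 : c ≠ 0 := fun h ↦ hne (by rw [h, zero_smul])
  have htriv (x : G) (hx : x ∈ commutator G) : ρ x = 1 := by
    have h1 : ρ x * ∑ y ∈ (commutator G : Set G).toFinset, ρ y =
        ∑ y ∈ (commutator G : Set G).toFinset, ρ y := by
      rw [Finset.mul_sum]
      refine Finset.sum_bij' (fun y _ ↦ x * y) (fun y _ ↦ x⁻¹ * y) ?_ ?_ ?_ ?_ ?_
      · intro y hy
        simpa [Subgroup.mul_mem_cancel_left _ hx] using hy
      · intro y hy
        simpa [Subgroup.mul_mem_cancel_left _ (inv_mem hx)] using hy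
      all_goals intros; simp
    rw [hc, mul_smul_comm, mul_one] at h1
    exact smul_right_injective _ hc0 h1
  obtain ⟨d, hd⟩ := exists_eq_smul_one ρ (ρ g) fun h ↦ by
    have : g * h = h * g * ⁅g⁻¹, h⁻¹⁆ := by simp [commutatorElement_def, mul_assoc]
    rw [commute_iff_eq, ← map_mul, ← map_mul, this, map_mul ρ (h * g), htriv _
      (Subgroup.commutator_mem_commutator (Subgroup.mem_top _) (Subgroup.mem_top _)), mul_one]
  rw [character, hd, map_smul, LinearMap.trace_one] at hg
  have hd0 := (smul_eq_zero.1 hg).resolve_right (Nat.cast_ne_zero.2 Module.finrank_pos.ne')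
  have h1 : ρ g * ρ g⁻¹ = 1 := by rw [← map_mul, mul_inv_cancel, map_one]
  rw [hd, hd0, zero_smul, zero_mul] at h1
  exact zero_ne_one h1

/-- A one-dimensional representation is scalar, given by a multiplicative character. -/
theorem exists_eq_smul_one_of_finrank_eq_one (ρ : Representation ℂ G V)
    (h : Module.finrank ℂ V = 1) : ∃ χ : G →* ℂ, ∀ g, ρ g = χ g • 1 := by
  refine ⟨LinearMap.det.comp ρ, fun g ↦ ?_⟩
  obtain ⟨c, hc, -⟩ := (ρ g).existsUnique_eq_smul_id_of_finrank_eq_one h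
  rw [MonoidHom.comp_apply, hc, LinearMap.det_smul, h]
  simp [Module.End.one_eq_id]

end Representation

/-- The product over all conjugacy classes of the value of a multiplicative character on the class
squares to one. -/
theorem MonoidHom.exists_conjClasses_lift_prod_sq_eq_one {G : Type*} [Group G]
    [Fintype (ConjClasses G)] (χ : G →* ℂ) :
    ∃ F : ConjClasses G → ℂ, (∀ g, F (ConjClasses.mk g) = χ g) ∧ (∏ c, F c) ^ 2 = 1 := by
  have hF (a b : G) (h : IsConj a b) : χ a = χ b := isConj_iff_eq.1 (χ.map_isConj h)
  have hI (a b : G) (h : IsConj a b) : ConjClasses.mk a⁻¹ = ConjClasses.mk b⁻¹ := by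
    obtain ⟨c, rfl⟩ := isConj_iff.1 h
    exact ConjClasses.mk_eq_mk_iff_isConj.2 (isConj_iff.2 ⟨c, by simp [mul_assoc]⟩)
  let F : ConjClasses G → ℂ := Quotient.lift χ hF
  let I : ConjClasses G → ConjClasses G := Quotient.lift (fun a : G ↦ ConjClasses.mk a⁻¹) hI
  have hII : Function.Involutive I := by
    rintro ⟨a⟩
    exact congrArg ConjClasses.mk (inv_inv a)
  refine ⟨F, fun _ ↦ rfl, ?_⟩
  rw [sq]
  nth_rewrite 2 [← hII.toPerm.prod_comp Finset.univ F (by simp)]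
  rw [← Finset.prod_mul_distrib]
  refine Finset.prod_eq_one ?_
  rintro ⟨a⟩ -
  change χ a * χ a⁻¹ = 1
  rw [← map_mul, mul_inv_cancel, map_one]

namespace Representation

variable {G V : Type*} [Group G] [AddCommGroup V] [Module ℂ V] [FiniteDimensional ℂ V]

theorem IsIrreducible.asAlgebraHom_prod_classSum_sq [Finite G] (ρ : Representation ℂ G V)
    [IsIrreducible ρ] (l : List (ConjClasses G)) (hnd : l.Nodup)
    (hall : ∀ c : ConjClasses G, c ∈ l) :
    ρ.asAlgebraHom
      (((l.map fun c => ∑ᶠ g ∈ c.carrier, MonoidAlgebra.of ℂ G g).prod) ^ 2) =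
    ρ.asAlgebraHom
      (((l.map fun c => (Nat.card c.carrier : ℂ)).prod ^ 2 / (Nat.card (commutator G) : ℂ)) •
        ∑ᶠ g ∈ (commutator G : Set G), MonoidAlgebra.of ℂ G g) := by
  classical
  have := Fintype.ofFinite G
  rw [map_smul, map_pow, map_list_prod, List.map_map]
  by_cases h : ∃ g, ρ.character g = 0
  · obtain ⟨g, hg⟩ := h
    rw [asAlgebraHom_sum_commutator_eq_zero ρ hg, smul_zero, List.prod_eq_zero, zero_pow two_ne_zero]
    exact List.mem_map.2 ⟨_, hall (ConjClasses.mk g), asAlgebraHom_classSum_eq_zero ρ hg⟩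
  push Not at h
  obtain ⟨χ, hχ⟩ := exists_eq_smul_one_of_finrank_eq_one ρ
    (finrank_eq_one_of_character_ne_zero ρ h)
  obtain ⟨F, hF, hF2⟩ := χ.exists_conjClasses_lift_prod_sq_eq_one
  have hclass : (⇑ρ.asAlgebraHom ∘ fun c : ConjClasses G ↦
      ∑ᶠ g ∈ c.carrier, MonoidAlgebra.of ℂ G g) =
      fun c ↦ algebraMap ℂ (Module.End ℂ V) (Nat.card c.carrier * F c) := by
    funext c
    rw [Function.comp_apply, asAlgebraHom_finsum_mem_of, Finset.sum_congr rfl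
      (g := fun _ ↦ F c • (1 : Module.End ℂ V)), Finset.sum_const, Set.toFinset_card,
      Fintype.card_eq_nat_card, Algebra.algebraMap_eq_smul_one, mul_smul, Nat.cast_smul_eq_nsmul]
    intro g hg
    rw [Set.mem_toFinset, ConjClasses.mem_carrier_iff_mk_eq] at hg
    rw [hχ, ← hg, hF]
  have hcomm (g : G) (hg : g ∈ commutator G) : χ g = 1 :=
    congrArg Units.val (MonoidHom.mem_ker.1
      (Abelianization.commutator_subset_ker χ.toHomUnits hg))
  have hsum : ∑ g ∈ (commutator G : Set G).toFinset, ρ g =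
      (Nat.card (commutator G) : ℂ) • (1 : Module.End ℂ V) := by
    rw [Finset.sum_congr rfl (g := fun _ ↦ (1 : Module.End ℂ V)), Finset.sum_const,
      Set.toFinset_card, Fintype.card_eq_nat_card, Nat.cast_smul_eq_nsmul]
    · rfl
    intro g hg
    rw [Set.mem_toFinset, SetLike.mem_coe] at hg
    rw [hχ, hcomm g hg, one_smul]
  have hl : (l.map F).prod = ∏ c, F c := by
    rw [← List.prod_toFinset _ hnd]
    congr 1
    ext c
    simp [hall]
  have hpos : (Nat.card (commutator G) : ℂ) ≠ 0 := Nat.cast_ne_zero.2 Nat.card_pos.ne'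
  rw [hclass, asAlgebraHom_finsum_mem_of, hsum, smul_smul, div_mul_cancel₀ _ hpos,
    ← Algebra.algebraMap_eq_smul_one]
  have : (l.map fun c ↦ algebraMap ℂ (Module.End ℂ V) (Nat.card c.carrier * F c)) =
      (l.map fun c ↦ (Nat.card c.carrier * F c)).map (algebraMap ℂ (Module.End ℂ V)) := by
    rw [List.map_map]; rfl
  rw [this, ← map_list_prod, List.prod_map_mul, ← map_pow, mul_pow, hl, hF2, mul_one]

end Representation

namespace Representation

theorem asAlgebraHom_ofModule' {G M : Type*} [Group G] [AddCommGroup M] [Module ℂ M]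
    [Module (MonoidAlgebra ℂ G) M] [IsScalarTower ℂ (MonoidAlgebra ℂ G) M] :
    (ofModule' (k := ℂ) (G := G) M).asAlgebraHom = Algebra.lsmul ℂ ℂ M :=
  (MonoidAlgebra.lift ℂ (M →ₗ[ℂ] M) G).apply_symm_apply _

theorem isIrreducible_ofModule' {G M : Type*} [Group G] [AddCommGroup M] [Module ℂ M]
    [Module (MonoidAlgebra ℂ G) M] [IsScalarTower ℂ (MonoidAlgebra ℂ G) M]
    [IsSimpleModule (MonoidAlgebra ℂ G) M] : IsIrreducible (ofModule' (k := ℂ) (G := G) M) := by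
  rw [irreducible_iff_isSimpleModule_asModule]
  let e : (ofModule' (k := ℂ) (G := G) M).asModule ≃ₗ[MonoidAlgebra ℂ G] M :=
    { (ofModule' (k := ℂ) (G := G) M).asModuleEquiv with
      map_smul' := fun r m ↦ ((ofModule' (k := ℂ) (G := G) M).asModuleEquiv_map_smul r m).trans
        (by rw [asAlgebraHom_ofModule']; rfl) }
  exact IsSimpleModule.congr e

end Representation

/-- Elements of the complex group algebra of a finite group which act in the same way in all
irreducible representations are equal. -/
theorem MonoidAlgebra.eq_of_forall_asAlgebraHom_eq.{u} {G : Type u} [Group G] [Finite G]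
    {x y : MonoidAlgebra ℂ G}
    (h : ∀ (V : Type u) [AddCommGroup V] [Module ℂ V] [FiniteDimensional ℂ V]
      (ρ : Representation ℂ G V) [Representation.IsIrreducible ρ],
      ρ.asAlgebraHom x = ρ.asAlgebraHom y) :
    x = y := by
  have : NeZero (Nat.card G : ℂ) := ⟨Nat.cast_ne_zero.2 Nat.card_pos.ne'⟩
  rw [← sub_eq_zero, ← Submodule.mem_bot (MonoidAlgebra ℂ G),
    ← IsSemisimpleRing.jacobson_eq_bot (MonoidAlgebra ℂ G), Ring.jacobson_eq_sInf_isMaximal,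
    Submodule.mem_sInf]
  intro I hI
  have : IsSimpleModule (MonoidAlgebra ℂ G) (MonoidAlgebra ℂ G ⧸ I) :=
    isSimpleModule_iff_isCoatom.2 (Ideal.isMaximal_def.1 hI)
  have := Representation.isIrreducible_ofModule' (G := G) (M := MonoidAlgebra ℂ G ⧸ I)
  have : FiniteDimensional ℂ (MonoidAlgebra ℂ G ⧸ I) := Module.Finite.trans (MonoidAlgebra ℂ G) _
  have h1 := LinearMap.congr_fun
    (h _ (Representation.ofModule' (k := ℂ) (G := G) (MonoidAlgebra ℂ G ⧸ I)))
    (Submodule.Quotient.mk 1)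
  simp only [Representation.asAlgebraHom_ofModule', Algebra.lsmul_coe] at h1
  rw [← Submodule.Quotient.mk_smul, ← Submodule.Quotient.mk_smul, smul_eq_mul, smul_eq_mul,
    mul_one, mul_one] at h1
  exact (Submodule.Quotient.eq I).1 h1

/-- **Harada's identity.** Let `G` be a finite group with conjugacy classes
`K_0, …, K_m`, let `K̂_j = ∑_{k ∈ K_j} k ∈ ℂ[G]` be the class sums, and let
`P = ∏ |K_j|`. Then `(∏ K̂_j)² = (P² / |G'|) • ∑_{g ∈ G'} g` in `ℂ[G]`.
Class sums are central, so the product is independent of the chosen enumeration of the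
conjugacy classes; we quantify over all enumerations. -/
theorem harada_identity_groupAlgebra
    {G : Type*} [Group G] [Finite G] (l : List (ConjClasses G))
    (hnd : l.Nodup) (hall : ∀ c : ConjClasses G, c ∈ l) :
    ((l.map fun c => ∑ᶠ g ∈ c.carrier, MonoidAlgebra.of ℂ G g).prod) ^ 2 =
      ((l.map fun c => (Nat.card c.carrier : ℂ)).prod ^ 2 / (Nat.card (commutator G) : ℂ)) •
        ∑ᶠ g ∈ (commutator G : Set G), MonoidAlgebra.of ℂ G g := by
  exact MonoidAlgebra.eq_of_forall_asAlgebraHom_eq fun V _ _ _ ρ _ ↦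
    Representation.IsIrreducible.asAlgebraHom_prod_classSum_sq ρ l hnd hall
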